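/- arXiv:0901.0407 — 2 statements merged into one kernel-verified Lean document; each statement's English description precedes it below -/
import Mathlib

section
/- For every integer v ≥ 2, (1/12)·(1 − 2/v)^2 + 2/v^3 ≥ 23/500, with equality if and only if v = 5. -/
theorem tau_sub_bound_eq {x : ℝ} (hx : x ≠ 0) :
    (1/12) * (1 - 2/x)^2 + 2/x^3 - 23/500 =
      (x - 5) * (14 * x^2 - 55 * x - 150) / (375 * x^3) := by
  field_simp
  ring

theorem tau_numerator_pos {v : ℕ} (hv : 2 ≤ v) (h5 : v ≠ 5) :
    0 < ((v:ℝ) - 5) * (14 * (v:ℝ)^2 - 55 * v - 150) := by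
  have h2 : (2:ℝ) ≤ v := by exact_mod_cast hv
  rcases lt_or_gt_of_ne h5 with h | h
  · have h4 : (v:ℝ) ≤ 4 := by exact_mod_cast Nat.le_of_lt_succ h
    exact mul_pos_of_neg_of_neg (by linarith) (by nlinarith)
  · have h6 : (6:ℝ) ≤ v := by exact_mod_cast h
    exact mul_pos (by linarith) (by nlinarith)

theorem complete_graph_tau_bound (v : ℕ) (hv : 2 ≤ v) :
    (1/12) * (1 - 2/(v:ℝ))^2 + 2/(v:ℝ)^3 ≥ 23/500 ∧
    ((1/12) * (1 - 2/(v:ℝ))^2 + 2/(v:ℝ)^3 = 23/500 ↔ v = 5) := by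
  by_cases h5 : v = 5
  · subst h5
    norm_num
  · have hpos : (0:ℝ) < v := by exact_mod_cast (by omega : 0 < v)
    have hlt : 0 < (1/12) * (1 - 2/(v:ℝ))^2 + 2/(v:ℝ)^3 - 23/500 := by
      rw [tau_sub_bound_eq hpos.ne']
      exact div_pos (tau_numerator_pos hv h5) (by positivity)
    exact ⟨by linarith, fun h => by linarith, fun h => absurd h h5⟩
end

section
/- Let n ≥ 2 be an integer, let L > 0 and R_a, R_b ≥ 0 be real numbers, and set R = R_a + R_b, a = R_a/n^2, b = R_b/n^2, d = L/(n(n−1)), s = a + b + d. Define f : ℝ → ℝ by f(x) = (x + a·d/s)·(L/n − x + d·b/s) / (L/n + (a·d + d·b)/s). Then (n/4)·∫_0^{L/n} (f′(x))^2 dx = (L/12)·((n−1)/n)^2 + ((n−1)/(6 n^2))·L^2/(L + R) + (L^3 + 3·L·(R_a − R_b)^2)/(12·n^2·(L + R)^2). -/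
/-- The interval integral of the square of a linear function with slope `-2 / T`. -/
theorem integral_sq_linear_div (B k T : ℝ) :
    ∫ x in (0 : ℝ)..B, ((B + k - 2 * x) / T) ^ 2 = (B / T ^ 2) * (B ^ 2 + 3 * k ^ 2) / 3 := by
  have h : ∀ x ∈ Set.uIcc 0 B,
      HasDerivAt (fun x : ℝ => -(B + k - 2 * x) ^ 3 / (6 * T ^ 2)) (((B + k - 2 * x) / T) ^ 2) x := by
    intro x _
    have h₁ : HasDerivAt (fun x : ℝ => B + k - 2 * x) (-(2 * 1)) x :=
      ((hasDerivAt_id' x).const_mul 2).const_sub (B + k)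
    refine (((h₁.fun_pow 3).fun_neg).div_const (6 * T ^ 2)).congr_deriv ?_
    push_cast
    ring
  rw [intervalIntegral.integral_eq_sub_of_hasDerivAt h
    (Continuous.intervalIntegrable (by fun_prop) _ _)]
  ring

theorem deriv_mul_sub_div (B p q T x : ℝ) :
    deriv (fun x : ℝ => (x + p) * (B - x + q) / T) x = (B + (q - p) - 2 * x) / T := by
  have h := ((((hasDerivAt_id' x).add_const p).fun_mul
    (((hasDerivAt_id' x).const_sub B).add_const q)).div_const T).deriv
  rw [h]
  ring

theorem edge_integral_identity_DA (n : ℕ) (hn : 2 ≤ n)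
    (L Ra Rb R a b d s : ℝ) (hL : 0 < L) (hRa : 0 ≤ Ra) (hRb : 0 ≤ Rb)
    (hR : R = Ra + Rb) (ha : a = Ra / n^2) (hb : b = Rb / n^2)
    (hd : d = L / (n * (n - 1))) (hs : s = a + b + d)
    (f : ℝ → ℝ)
    (hf : ∀ x, f x = (x + a * d / s) * (L / n - x + d * b / s) / (L / n + (a * d + d * b) / s)) :
    ((n:ℝ)/4) * ∫ x in (0:ℝ)..(L/n), (deriv f x)^2 =
      (L/12) * (((n:ℝ) - 1)/n)^2 + (((n:ℝ) - 1)/(6 * n^2)) * L^2 / (L + R)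
        + (L^3 + 3 * L * (Ra - Rb)^2) / (12 * n^2 * (L + R)^2) := by
  rw [funext hf]
  simp only [deriv_mul_sub_div, integral_sq_linear_div]
  have hn' : (2 : ℝ) ≤ n := by exact_mod_cast hn
  generalize (n : ℝ) = m at *
  have hm : 0 < m := by linarith
  have hm₁ : 0 < m - 1 := by linarith
  have hR₀ : 0 ≤ R := by rw [hR]; positivity
  have hLR : 0 < L + R := by positivity
  have hD : 0 < (m - 1) * R + m * L := by positivity
  have hs' : s = ((m - 1) * R + m * L) / (m ^ 2 * (m - 1)) := by
    rw [hs, ha, hb, hd, hR]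
    field_simp
  have hp : a * d / s = Ra * L / (m * ((m - 1) * R + m * L)) := by
    rw [hs', ha, hd]
    field_simp
  have hq : d * b / s = Rb * L / (m * ((m - 1) * R + m * L)) := by
    rw [hs', hb, hd]
    field_simp
  have hT : L / m + (a * d + d * b) / s = L * (L + R) / ((m - 1) * R + m * L) := by
    rw [add_div, hp, hq]
    field_simp
    rw [hR]
    ring
  rw [hT, hp, hq]
  field_simp
  ring
end
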